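/- arXiv:1108.5578 — 2 statements merged into one kernel-verified Lean document; each statement's English description precedes it below -/
import Mathlib

section
/- Let K be a compact metric space. Then for the generic f ∈ C(K) the graph of f satisfies dim_tH graph(f) = dim_tH K, where graph(f) = {(x, f(x)) : x ∈ K} ⊆ K × ℝ. -/
open MeasureTheory Topology Metric Set
open scoped Classical

/-- Hausdorff dimension of a subset of a metric space, as an extended real number, with the
convention that the empty set has dimension `-1`. -/
noncomputable def hdim {X : Type*} [EMetricSpace X] (s : Set X) : EReal :=
  if s = ∅ then -1 else (dimH s : EReal)

/-- The topological Hausdorff dimension of a metric space `X`: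
`dim_tH X = inf {d : X has a basis 𝒰 such that dim_H ∂U ≤ d − 1 for every U ∈ 𝒰}`, with the
convention `dim_tH ∅ = -1` (the infimum of the empty set of extended reals being `⊤`). -/
noncomputable def tHdim (X : Type*) [MetricSpace X] : EReal :=
  if Nonempty X then
    sInf {d : EReal | ∃ 𝒰 : Set (Set X), TopologicalSpace.IsTopologicalBasis 𝒰 ∧
      ∀ U ∈ 𝒰, hdim (frontier U) ≤ d - 1}
  else -1

/-- A countable open cover of `s` whose members have diameter at most `ε` and whose `t`-th powers
of diameters add up to at most `ε`. -/
def HasFineOpenCover {X : Type*} [EMetricSpace X] (t : ℝ) (ε : ENNReal) (s : Set X) : Prop :=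
  ∃ U : ℕ → Set X, (∀ n, IsOpen (U n)) ∧ s ⊆ ⋃ n, U n ∧ (∀ n, ediam (U n) ≤ ε) ∧
    ∑' n, ediam (U n) ^ t ≤ ε

theorem exists_isOpen_superset_ediam_rpow_le {X : Type*} [EMetricSpace X] {t : ℝ} (ht : 0 < t)
    {s : Set X} {ε η : ENNReal} (hs : ediam s < ε) (hη : η ≠ 0) :
    ∃ U : Set X, IsOpen U ∧ s ⊆ U ∧ ediam U ≤ ε ∧
      ediam U ^ t ≤ (⨆ _ : s.Nonempty, ediam s ^ t) + η := by
  rcases s.eq_empty_or_nonempty with rfl | hne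
  · exact ⟨∅, isOpen_empty, subset_rfl, by simp, by simp [ht]⟩
  have hlt : ediam s ^ t < ediam s ^ t + η :=
    ENNReal.lt_add_right (ENNReal.rpow_lt_top_of_nonneg ht.le hs.ne_top).ne hη
  have hlim : Filter.Tendsto (fun δ : NNReal => ediam s + 2 * (δ : ENNReal)) (𝓝[>] 0)
      (𝓝 (ediam s)) := by
    have h : Continuous fun δ : NNReal => ediam s + 2 * (δ : ENNReal) :=
      continuous_const.add
        ((ENNReal.continuous_const_mul (by simp)).comp ENNReal.continuous_coe)
    simpa using (h.tendsto 0).mono_left nhdsWithin_le_nhds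
  have hpow := (ENNReal.continuous_rpow_const (y := t)).tendsto (ediam s) |>.comp hlim
  obtain ⟨δ, hδ₁, hδ₂, hδ₀⟩ := ((hlim.eventually_le_const hs).and
    ((hpow.eventually_le_const hlt).and self_mem_nhdsWithin)).exists
  refine ⟨thickening δ s, isOpen_thickening, self_subset_thickening (by exact_mod_cast hδ₀) s,
    (ediam_thickening_le δ).trans hδ₁, ?_⟩
  rw [iSup_pos hne]
  exact (ENNReal.rpow_le_rpow (ediam_thickening_le δ) ht.le).trans hδ₂

theorem hasFineOpenCover_of_hausdorffMeasure_eq_zero {X : Type*} [EMetricSpace X]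
    [MeasurableSpace X] [BorelSpace X] {t : ℝ} (ht : 0 < t) {s : Set X} (hs : μH[t] s = 0)
    {ε : ENNReal} (hε : ε ≠ 0) (hε' : ε ≠ ⊤) : HasFineOpenCover t ε s := by
  have hε₂ : 0 < ε / 2 := ENNReal.half_pos hε
  have hlt := hs.trans_lt hε₂
  rw [Measure.hausdorffMeasure_apply] at hlt
  have hlt := (le_iSup₂ (ε / 2) hε₂).trans_lt hlt
  simp only [iInf_lt_iff] at hlt
  obtain ⟨A, hsA, hdA, hsum⟩ := hlt
  obtain ⟨η, hη, hηsum⟩ := ENNReal.exists_pos_sum_of_countable' hε₂.ne' ℕ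
  choose U hUo hAU hUd hUt using fun n => exists_isOpen_superset_ediam_rpow_le ht
    ((hdA n).trans_lt (ENNReal.half_lt_self hε hε')) (hη n).ne'
  refine ⟨U, hUo, hsA.trans (iUnion_mono hAU), hUd, ?_⟩
  calc ∑' n, ediam (U n) ^ t ≤ ∑' n, ((⨆ _ : (A n).Nonempty, ediam (A n) ^ t) + η n) :=
        ENNReal.tsum_le_tsum hUt
    _ = (∑' n, ⨆ _ : (A n).Nonempty, ediam (A n) ^ t) + ∑' n, η n := ENNReal.tsum_add
    _ ≤ ε / 2 + ε / 2 := add_le_add hsum.le hηsum.le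
    _ = ε := ENNReal.add_halves ε

theorem hausdorffMeasure_eq_zero_of_hasFineOpenCover {X : Type*} [EMetricSpace X]
    [MeasurableSpace X] [BorelSpace X] {t : ℝ} {s : Set X}
    (h : ∀ n : ℕ, HasFineOpenCover t ((n : ENNReal) + 1)⁻¹ s) : μH[t] s = 0 := by
  choose U _ hsU hUd hUt using h
  have hlim : Filter.Tendsto (fun n : ℕ => ((n : ENNReal) + 1)⁻¹) Filter.atTop (𝓝 0) := by
    simpa using! (Filter.tendsto_add_atTop_iff_nat 1).2 ENNReal.tendsto_inv_nat_nhds_zero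
  rw [← nonpos_iff_eq_zero]
  refine (Measure.hausdorffMeasure_le_liminf_tsum t s _ hlim U
    (Filter.Eventually.of_forall hUd) (Filter.Eventually.of_forall hsU)).trans ?_
  exact (Filter.liminf_le_liminf (Filter.Eventually.of_forall hUt)).trans_eq hlim.liminf_eq

/-- The algebra of Lipschitz real functions on a compact metric space. -/
def lipschitzSubalgebra (K : Type*) [MetricSpace K] [CompactSpace K] : Subalgebra ℝ C(K, ℝ) where
  carrier := {f | ∃ C, LipschitzWith C f}
  mul_mem' := by
    rintro f g ⟨A, hf⟩ ⟨B, hg⟩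
    refine ⟨‖f‖₊ * B + ‖g‖₊ * A, LipschitzWith.of_dist_le_mul fun x y => ?_⟩
    have h₁ := hf.dist_le_mul x y
    have h₂ := hg.dist_le_mul x y
    have h₃ := f.norm_coe_le_norm x
    have h₄ := g.norm_coe_le_norm y
    rw [Real.dist_eq] at *
    rw [Real.norm_eq_abs] at h₃ h₄
    calc |(f * g) x - (f * g) y| = |f x * (g x - g y) + g y * (f x - f y)| := by
          simp only [ContinuousMap.mul_apply]; ring_nf
      _ ≤ |f x| * |g x - g y| + |g y| * |f x - f y| := by
          rw [← abs_mul, ← abs_mul]; exact abs_add_le _ _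
      _ ≤ ‖f‖ * (B * dist x y) + ‖g‖ * (A * dist x y) := by gcongr
      _ = _ := by push_cast; ring
  add_mem' := by
    rintro f g ⟨A, hf⟩ ⟨B, hg⟩
    exact ⟨A + B, hf.add hg⟩
  algebraMap_mem' r := ⟨0, LipschitzWith.const r⟩

theorem dense_setOf_lipschitzWith (K : Type*) [MetricSpace K] [CompactSpace K] :
    Dense {f : C(K, ℝ) | ∃ C, LipschitzWith C f} := by
  have h := ContinuousMap.subalgebra_topologicalClosure_eq_top_of_separatesPoints
    (lipschitzSubalgebra K) fun x y hxy =>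
      ⟨fun z => dist z y, ⟨⟨fun z => dist z y, by fun_prop⟩, ⟨1, LipschitzWith.dist_left y⟩, rfl⟩,
        by simpa using hxy⟩
  intro f
  have hf : f ∈ (lipschitzSubalgebra K).topologicalClosure := by rw [h]; trivial
  exact hf

section GenericGraph

variable {K : Type*} [MetricSpace K] [CompactSpace K]

theorem isOpen_setOf_hasFineOpenCover_graph {F : Set K} (hF : IsClosed F) (t : ℝ) (ε : ENNReal) :
    IsOpen {f : C(K, ℝ) | HasFineOpenCover t ε ((fun x => (x, f x)) '' F)} := by
  rw [isOpen_iff_mem_nhds]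
  rintro f ⟨U, hUo, hU, hUd, hUt⟩
  have hO : IsOpen (⋃ n, U n) := isOpen_iUnion hUo
  have hcont : Continuous fun g : C(K, ℝ) => (ContinuousMap.id K).prodMk g :=
    ContinuousMap.continuous_of_continuous_uncurry _
      (continuous_snd.prodMk (continuous_fst.eval continuous_snd))
  filter_upwards [((ContinuousMap.isOpen_setOfPred_mapsTo hF.isCompact hO).preimage
    hcont).mem_nhds (show MapsTo _ _ _ from mapsTo_iff_image_subset.2 hU)] with g hg
  exact ⟨U, hUo, mapsTo_iff_image_subset.1 hg, hUd, hUt⟩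

theorem eventually_residual_hasFineOpenCover_graph {F : Set K} (hF : IsClosed F) {t : NNReal}
    (ht : dimH F < t) {ε : ENNReal} (hε : ε ≠ 0) (hε' : ε ≠ ⊤) :
    ∀ᶠ f : C(K, ℝ) in residual C(K, ℝ), HasFineOpenCover t ε ((fun x => (x, f x)) '' F) := by
  refine residual_of_dense_open (isOpen_setOf_hasFineOpenCover_graph hF t ε)
    ((dense_setOf_lipschitzWith K).mono ?_)
  rintro f ⟨C, hf⟩
  borelize (K × ℝ)
  have ht₀ : (0 : ℝ) < t := by exact_mod_cast zero_le.trans_lt ht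
  exact hasFineOpenCover_of_hausdorffMeasure_eq_zero ht₀ (hausdorffMeasure_of_dimH_lt
    (((LipschitzWith.id.prodMk hf).dimH_image_le F).trans_lt ht)) hε hε'

theorem eventually_residual_dimH_graph_le {F : Set K} (hF : IsClosed F) :
    ∀ᶠ f : C(K, ℝ) in residual C(K, ℝ), dimH ((fun x => (x, f x)) '' F) ≤ dimH F := by
  rcases eq_or_ne (dimH F) ⊤ with htop | htop
  · simp [htop]
  obtain ⟨u, -, hu, hlim⟩ := exists_seq_strictAnti_tendsto (dimH F).toNNReal
  have hFu : ∀ m, dimH F < u m := fun m => by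
    rw [← ENNReal.coe_toNNReal htop]
    exact_mod_cast hu m
  have h : ∀ᶠ f : C(K, ℝ) in residual C(K, ℝ), ∀ m n : ℕ,
      HasFineOpenCover (u m) ((n : ENNReal) + 1)⁻¹ ((fun x => (x, f x)) '' F) :=
    eventually_countable_forall.2 fun m => eventually_countable_forall.2 fun n =>
      eventually_residual_hasFineOpenCover_graph hF (hFu m) (by simp) (by simp)
  filter_upwards [h] with f hf
  borelize (K × ℝ)
  have hlim' : Filter.Tendsto (fun m => (u m : ENNReal)) Filter.atTop (𝓝 (dimH F)) := by
    rw [← ENNReal.coe_toNNReal htop]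
    exact ENNReal.tendsto_coe.2 hlim
  refine ge_of_tendsto' hlim' fun m => dimH_le_of_hausdorffMeasure_ne_top ?_
  rw [hausdorffMeasure_eq_zero_of_hasFineOpenCover (hf m)]
  exact ENNReal.zero_ne_top

end GenericGraph

theorem hdim_image_le {X Y : Type*} [EMetricSpace X] [EMetricSpace Y] {g : X → Y} {s : Set X}
    (h : dimH (g '' s) ≤ dimH s) : hdim (g '' s) ≤ hdim s := by
  unfold hdim
  simp only [image_eq_empty]
  split_ifs
  · exact le_rfl
  · exact_mod_cast h

/-- The bounds admitted in the definition of `tHdim`. -/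
def tHdimBounds (X : Type*) [MetricSpace X] : Set EReal :=
  {d : EReal | ∃ 𝒰 : Set (Set X), TopologicalSpace.IsTopologicalBasis 𝒰 ∧
    ∀ U ∈ 𝒰, hdim (frontier U) ≤ d - 1}

theorem tHdim_of_nonempty (X : Type*) [MetricSpace X] [h : Nonempty X] :
    tHdim X = sInf (tHdimBounds X) :=
  if_pos h

theorem mem_tHdimBounds_of_homeomorph {X Y : Type*} [MetricSpace X] [MetricSpace Y] (e : X ≃ₜ Y)
    {𝒰 : Set (Set X)} (h𝒰 : TopologicalSpace.IsTopologicalBasis 𝒰) {d : EReal}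
    (hd : ∀ U ∈ 𝒰, hdim (frontier U) ≤ d - 1)
    (he : ∀ U ∈ 𝒰, dimH (e '' frontier U) ≤ dimH (frontier U)) : d ∈ tHdimBounds Y := by
  refine ⟨_, h𝒰.isInducing e.symm.isInducing, ?_⟩
  rintro _ ⟨U, hU, rfl⟩
  rw [e.preimage_symm, ← e.image_frontier]
  exact (hdim_image_le (he U hU)).trans (hd U hU)

/-- A continuous function identifies its domain with its graph. -/
def graphHomeomorph {X Y : Type*} [TopologicalSpace X] [TopologicalSpace Y] (f : C(X, Y)) :
    X ≃ₜ Set.range fun x => (x, f x) where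
  toFun x := ⟨(x, f x), x, rfl⟩
  invFun p := p.1.1
  left_inv _ := rfl
  right_inv := by
    rintro ⟨_, x, rfl⟩
    rfl
  continuous_toFun := by fun_prop
  continuous_invFun := by fun_prop

theorem dimH_graphHomeomorph_image {X Y : Type*} [MetricSpace X] [MetricSpace Y] (f : C(X, Y))
    (s : Set X) : dimH (graphHomeomorph f '' s) = dimH ((fun x => (x, f x)) '' s) := by
  rw [← isometry_subtype_coe.dimH_image, image_image]
  rfl

theorem tHdimBounds_graph_subset {X Y : Type*} [MetricSpace X] [MetricSpace Y] (f : C(X, Y)) :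
    tHdimBounds (Set.range fun x => (x, f x)) ⊆ tHdimBounds X := by
  rintro d ⟨𝒰, h𝒰, hd⟩
  refine mem_tHdimBounds_of_homeomorph (graphHomeomorph f).symm h𝒰 hd fun U _ => ?_
  exact (LipschitzWith.prod_fst.comp (LipschitzWith.subtype_val _)).dimH_image_le _

theorem eventually_residual_mem_tHdimBounds_graph {K : Type*} [MetricSpace K] [CompactSpace K]
    {d : EReal} (hd : d ∈ tHdimBounds K) :
    ∀ᶠ f : C(K, ℝ) in residual C(K, ℝ), d ∈ tHdimBounds (Set.range fun x => (x, f x)) := by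
  obtain ⟨𝒰, h𝒰, hd⟩ := hd
  obtain ⟨𝒱, h𝒱𝒰, hcount, h𝒱⟩ := h𝒰.exists_countable
  have h : ∀ᶠ f : C(K, ℝ) in residual C(K, ℝ), ∀ U ∈ 𝒱,
      dimH ((fun x => (x, f x)) '' frontier U) ≤ dimH (frontier U) :=
    (eventually_countable_ball hcount).2 fun U _ =>
      eventually_residual_dimH_graph_le isClosed_frontier
  filter_upwards [h] with f hf
  refine mem_tHdimBounds_of_homeomorph (graphHomeomorph f) h𝒱 (fun U hU => hd U (h𝒱𝒰 hU)) ?_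
  intro U hU
  rw [dimH_graphHomeomorph_image]
  exact hf U hU

/-- Let `K` be a compact metric space. Then for the generic `f ∈ C(K)` the
graph of `f`, as a metric subspace of `K × ℝ`, has topological Hausdorff dimension equal to
`dim_tH K`. -/
theorem generic_graph_topological_hausdorff_dimension
    {K : Type*} [MetricSpace K] [CompactSpace K] :
    {f : C(K, ℝ) | tHdim ↥(Set.range fun x => (x, f x)) = tHdim K} ∈ residual C(K, ℝ) := by
  rcases isEmpty_or_nonempty K with hK | hK
  · have h : ∀ f : C(K, ℝ), tHdim ↥(Set.range fun x => (x, f x)) = tHdim K := fun f => by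
      have : IsEmpty ↥(Set.range fun x => (x, f x)) := (graphHomeomorph f).symm.isEmpty
      simp [tHdim]
    simp [h]
  have hne : (tHdimBounds K).Nonempty :=
    ⟨⊤, _, TopologicalSpace.isTopologicalBasis_opens, fun U _ => le_top.trans_eq (EReal.top_sub_coe 1).symm⟩
  obtain ⟨d, -, hlim, hd⟩ := exists_seq_tendsto_sInf hne (OrderBot.bddBelow _)
  filter_upwards [eventually_countable_forall.2 fun n =>
    eventually_residual_mem_tHdimBounds_graph (hd n)] with f hf
  have : Nonempty ↥(Set.range fun x => (x, f x)) := hK.map (graphHomeomorph f)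
  rw [tHdim_of_nonempty, tHdim_of_nonempty]
  exact le_antisymm (ge_of_tendsto' hlim fun n => sInf_le (hf n))
    (sInf_le_sInf (tHdimBounds_graph_subset f))
end

section
/- Let K be a compact metric space that is not totally disconnected (equivalently, has positive topological dimension). Then for the generic f ∈ C(K) one has sup{dim_H f⁻¹(y) : y ∈ ℝ} = dim_tH K − 1. -/
open MeasureTheory Topology Metric Set
open scoped Classical

lemma hdim_mono {X : Type*} [EMetricSpace X] {s t : Set X} (h : s ⊆ t) : hdim s ≤ hdim t := by
  unfold hdim
  split_ifs with hs ht ht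
  · exact le_rfl
  · exact (by norm_num : (-1 : EReal) ≤ 0).trans (EReal.coe_ennreal_nonneg _)
  · exact absurd (subset_empty_iff.1 (ht ▸ h)) hs
  · exact_mod_cast dimH_mono h

lemma hdim_nonneg {X : Type*} [EMetricSpace X] {s : Set X} (h : s.Nonempty) : 0 ≤ hdim s := by
  rw [hdim, if_neg h.ne_empty]
  exact EReal.coe_ennreal_nonneg _

lemma hdim_le_of_hausdorffMeasure_eq_zero {X : Type*} [EMetricSpace X] [MeasurableSpace X]
    [BorelSpace X] {s : NNReal} {E : Set X} (h : μH[s] E = 0) : hdim E ≤ ((s : ℝ) : EReal) := by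
  unfold hdim
  split_ifs
  · exact (by norm_num : (-1 : EReal) ≤ 0).trans (EReal.coe_nonneg.2 s.coe_nonneg)
  · have : dimH E ≤ s := dimH_le_of_hausdorffMeasure_ne_top (by simp [h])
    rw [← EReal.coe_nnreal_eq_coe_real]
    exact EReal.coe_ennreal_le_coe_ennreal_iff.2 this

lemma hausdorffMeasure_eq_zero_of_hdim_lt {X : Type*} [EMetricSpace X] [MeasurableSpace X]
    [BorelSpace X] {s : NNReal} {E : Set X} (h : hdim E < ((s : ℝ) : EReal)) : μH[s] E = 0 := by
  unfold hdim at h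
  split_ifs at h with hE
  · simp [hE]
  · apply hausdorffMeasure_of_dimH_lt
    rw [← EReal.coe_nnreal_eq_coe_real] at h
    exact EReal.coe_ennreal_lt_coe_ennreal_iff.1 h

/-- `E` has a countable cover whose `s`-dimensional weight is at most `ε`. -/
def HasCover {X : Type*} [EMetricSpace X] (s : ℝ) (ε : ENNReal) (E : Set X) : Prop :=
  ∃ t : ℕ → Set X, E ⊆ ⋃ n, t n ∧ ∑' n, ediam (t n) ^ s ≤ ε

lemma HasCover.mono {X : Type*} [EMetricSpace X] {s : ℝ} {ε : ENNReal} {E F : Set X}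
    (h : HasCover s ε F) (hEF : E ⊆ F) : HasCover s ε E := by
  obtain ⟨t, ht, hs⟩ := h
  exact ⟨t, hEF.trans ht, hs⟩

lemma HasCover.union {X : Type*} [EMetricSpace X] {s : ℝ} {ε δ : ENNReal} {E F : Set X}
    (h : HasCover s ε E) (hF : ediam F ^ s ≤ δ) : HasCover s (δ + ε) (F ∪ E) := by
  obtain ⟨t, ht, hs⟩ := h
  refine ⟨fun n => Nat.casesOn n F t, ?_, ?_⟩
  · rintro x (hx | hx)
    · exact mem_iUnion.2 ⟨0, hx⟩
    · obtain ⟨n, hn⟩ := mem_iUnion.1 (ht hx)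
      exact mem_iUnion.2 ⟨n + 1, hn⟩
  · rw [tsum_eq_zero_add' ENNReal.summable]
    exact add_le_add hF hs

lemma exists_thickening_ediam_rpow_le {X : Type*} [MetricSpace X] {s : ℝ} (hs : 0 ≤ s)
    (E : Set X) {ε : ENNReal} (hε : ε ≠ 0) :
    ∃ r : NNReal, 0 < r ∧ ediam (thickening r E) ^ s ≤ ediam E ^ s + ε := by
  by_cases htop : ediam E ^ s = ⊤
  · exact ⟨1, one_pos, by simp [htop]⟩
  have hc : Continuous fun r : NNReal => (ediam E + 2 * r) ^ s := by
    refine ENNReal.continuous_rpow_const.comp (continuous_const.add ?_)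
    exact (ENNReal.continuous_const_mul (by simp)).comp ENNReal.continuous_coe
  have hlt : (ediam E + 2 * ((0 : NNReal) : ENNReal)) ^ s < ediam E ^ s + ε := by
    simpa using ENNReal.lt_add_right htop hε
  have hev : ∀ᶠ r : NNReal in 𝓝[>] 0, (ediam E + 2 * r) ^ s < ediam E ^ s + ε :=
    (hc.tendsto 0 |>.eventually_lt_const hlt).filter_mono nhdsWithin_le_nhds
  obtain ⟨r, hr, hr0⟩ := (hev.and self_mem_nhdsWithin).exists
  exact ⟨r, hr0, (ENNReal.rpow_le_rpow (ediam_thickening_le r) hs).trans hr.le⟩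

lemma exists_isOpen_hasCover {X : Type*} [MetricSpace X] [MeasurableSpace X]
    [BorelSpace X] {s : ℝ} (hs : 0 < s) {A : Set X} (h : μH[s] A = 0) {ε : ENNReal} (hε : ε ≠ 0) :
    ∃ N, IsOpen N ∧ A ⊆ N ∧ HasCover s ε N := by
  have h2 : ε / 2 ≠ 0 := by simpa using hε
  rw [Measure.hausdorffMeasure_apply] at h
  have h1 : (⨅ (t : ℕ → Set X) (_ : A ⊆ ⋃ n, t n) (_ : ∀ n, ediam (t n) ≤ ⊤),
      ∑' n, ⨆ _ : (t n).Nonempty, ediam (t n) ^ s) = 0 :=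
    le_antisymm ((le_iSup₂ (f := fun (r : ENNReal) (_ : 0 < r) =>
      ⨅ (t : ℕ → Set X) (_ : A ⊆ ⋃ n, t n) (_ : ∀ n, ediam (t n) ≤ r),
        ∑' n, ⨆ _ : (t n).Nonempty, ediam (t n) ^ s) ⊤ (by simp)).trans h.le) bot_le
  have h3 := h1.trans_lt (pos_iff_ne_zero.2 h2)
  simp only [iInf_lt_iff] at h3
  obtain ⟨t, hA, -, ht⟩ := h3
  have ht' : ∑' n, ediam (t n) ^ s ≤ ε / 2 := by
    refine le_trans (ENNReal.tsum_le_tsum fun n => ?_) ht.le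
    rcases (t n).eq_empty_or_nonempty with hn | hn
    · simp [hn, hs]
    · simp [hn]
  obtain ⟨e, he0, he⟩ := ENNReal.exists_pos_sum_of_countable h2 ℕ
  choose r hr0 hr using fun n => exists_thickening_ediam_rpow_le hs.le (t n)
    (ε := e n) (by simpa using (he0 n).ne')
  refine ⟨⋃ n, thickening (r n) (t n), isOpen_iUnion fun n => isOpen_thickening,
    hA.trans (iUnion_mono fun n => self_subset_thickening (hr0 n) _),
    fun n => thickening (r n) (t n), le_rfl, ?_⟩
  calc _ ≤ ∑' n, (ediam (t n) ^ s + e n) := ENNReal.tsum_le_tsum hr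
    _ = ∑' n, ediam (t n) ^ s + ∑' n, (e n : ENNReal) := ENNReal.tsum_add
    _ ≤ ε / 2 + ε / 2 := add_le_add ht' he.le
    _ = ε := ENNReal.add_halves ε

lemma hausdorffMeasure_eq_zero_of_hasCover {X : Type*} [EMetricSpace X] [MeasurableSpace X]
    [BorelSpace X] {s : ℝ} (hs : 0 < s) {E : Set X}
    (h : ∀ n : ℕ, HasCover s (n : ENNReal)⁻¹ E) : μH[s] E = 0 := by
  choose t ht hts using h
  have hlim : Filter.Tendsto (fun n : ℕ => ((n : ENNReal)⁻¹) ^ s⁻¹) Filter.atTop (𝓝 0) := by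
    have := (ENNReal.continuous_rpow_const (y := s⁻¹)).tendsto 0 |>.comp
      ENNReal.tendsto_inv_nat_nhds_zero
    simpa [hs, Function.comp_def] using this
  refine le_antisymm ((Measure.hausdorffMeasure_le_liminf_tsum s E
    (fun n : ℕ => ((n : ENNReal)⁻¹) ^ s⁻¹) hlim t (Filter.Eventually.of_forall fun n i => ?_)
    (Filter.Eventually.of_forall ht)).trans ?_) bot_le
  · rw [ENNReal.le_rpow_inv_iff hs]
    exact (ENNReal.le_tsum i).trans (hts n)
  · calc _ ≤ Filter.liminf (fun n : ℕ => (n : ENNReal)⁻¹) Filter.atTop :=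
        Filter.liminf_le_liminf (Filter.Eventually.of_forall hts)
      _ = 0 := ENNReal.tendsto_inv_nat_nhds_zero.liminf_eq

lemma mem_residual_of_forall_exists_ball_subset {Y : Type*} [MetricSpace Y] {S : Set Y}
    (h : ∀ y, ∀ δ > 0, ∃ z ∈ ball y δ, ∃ η > 0, ball z η ⊆ S) : S ∈ residual Y := by
  refine Filter.mem_of_superset (residual_of_dense_open isOpen_interior ?_) interior_subset
  refine Metric.dense_iff.2 fun y δ hδ => ?_
  obtain ⟨z, hz, η, hη, hS⟩ := h y δ hδ
  exact ⟨z, hz, interior_mono hS (by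
    rw [isOpen_ball.interior_eq]
    exact mem_ball_self hη)⟩

lemma totallyDisconnectedSpace_of_frontier_eq_empty {X : Type*} [TopologicalSpace X] [T1Space X]
    {𝒰 : Set (Set X)} (hB : TopologicalSpace.IsTopologicalBasis 𝒰)
    (h : ∀ U ∈ 𝒰, frontier U = ∅) : TotallyDisconnectedSpace X := by
  refine ⟨fun t _ ht x hx y hy => ?_⟩
  by_contra hxy
  obtain ⟨U, hU, hxU, hUy⟩ := hB.exists_subset_of_mem_open (show x ∈ ({y}ᶜ : Set X) from hxy)
    isOpen_compl_singleton
  have hclopen : IsClopen U := isClopen_iff_frontier_eq_empty.2 (h U hU)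
  exact hUy (ht.subset_isClopen hclopen ⟨x, hx, hxU⟩ hy) rfl

lemma exists_injective_abs_sub_le {n : ℕ} (a : Fin n → ℝ) {δ : ℝ} (hδ : 0 < δ) :
    ∃ c : Fin n → ℝ, Function.Injective c ∧ ∀ i, |c i - a i| ≤ δ := by
  have hfin : (range fun p : Fin n × Fin n => (a p.2 - a p.1) / ((p.1 : ℝ) - p.2)).Finite :=
    finite_range _
  have hn : (0 : ℝ) < n + 1 := by positivity
  obtain ⟨τ, hτ, hτn⟩ := (Ioo_infinite (div_pos hδ hn)).exists_notMem_finite hfin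
  refine ⟨fun i => a i + τ * i, fun i j hij => ?_, fun i => ?_⟩
  · by_contra hne
    refine hτn ⟨(i, j), ?_⟩
    have hne' : ((i : ℕ) : ℝ) - (j : ℕ) ≠ 0 := by
      rw [sub_ne_zero]
      exact fun h => hne (Fin.ext (by exact_mod_cast h))
    simp only at hij ⊢
    rw [div_eq_iff hne']
    linarith
  · have hi : ((i : ℕ) : ℝ) ≤ n + 1 := by
      have := i.2.le
      have : ((i : ℕ) : ℝ) ≤ n := by exact_mod_cast this
      linarith
    have h0 : (0 : ℝ) ≤ τ * (i : ℕ) := mul_nonneg hτ.1.le (by positivity)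
    rw [add_sub_cancel_left, abs_of_nonneg h0]
    calc τ * (i : ℕ) ≤ δ / (n + 1) * (n + 1) :=
        mul_le_mul hτ.2.le hi (by positivity) (by positivity)
      _ = δ := by field_simp

lemma exists_pos_two_mul_lt_abs_sub {ι : Type*} [Finite ι] {c : ι → ℝ}
    (hc : Function.Injective c) : ∃ η > 0, ∀ i j, i ≠ j → 2 * η < |c i - c j| := by
  have hev : ∀ᶠ η : ℝ in 𝓝[>] 0, ∀ i j, i ≠ j → 2 * η < |c i - c j| := by
    refine Filter.eventually_all.2 fun i => Filter.eventually_all.2 fun j => ?_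
    by_cases hij : i = j
    · simp [hij]
    have hpos : 2 * (0 : ℝ) < |c i - c j| := by
      simpa [sub_eq_zero] using hc.ne hij
    have : Filter.Tendsto (fun η : ℝ => 2 * η) (𝓝[>] 0) (𝓝 (2 * 0)) :=
      ((continuous_const_mul 2).tendsto 0).mono_left nhdsWithin_le_nhds
    filter_upwards [this.eventually_lt_const hpos] with η hη _ using hη
  obtain ⟨η, hη, h0⟩ := (hev.and self_mem_nhdsWithin).exists
  exact ⟨η, h0, hη⟩

lemma eventually_mem_iff_of_notMem_frontier {X : Type*} [TopologicalSpace X] {U : Set X} {x : X}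
    (h : x ∉ frontier U) : ∀ᶠ y in 𝓝 x, y ∈ U ↔ x ∈ U := by
  by_cases hx : x ∈ U
  · have : x ∈ interior U := by
      by_contra hi
      exact h ⟨subset_closure hx, hi⟩
    filter_upwards [mem_interior_iff_mem_nhds.1 this] with y hy
    simp [hx, hy]
  · have : x ∉ closure U := fun hc => h ⟨hc, fun hi => hx (interior_subset hi)⟩
    filter_upwards [isClosed_closure.isOpen_compl.mem_nhds this] with y hy
    have : y ∉ U := fun hyU => hy (subset_closure hyU)
    simp [hx, this]

/-- A continuous function can be approximated by one which, outside any neighbourhood of the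
boundaries of a fine open cover, takes the prescribed distinct values `c i` on disjoint
pieces of the members of the cover. -/
lemma exists_approx_piecewise_const {X : Type*} [TopologicalSpace X] [CompactSpace X]
    [NormalSpace X] {n : ℕ} {U : Fin n → Set X} (hcov : ∀ x, ∃ i, x ∈ U i) {N : Set X}
    (hN : IsOpen N) (hfr : ∀ i, frontier (U i) ⊆ N) (f : C(X, ℝ)) (c : Fin n → ℝ) {δ : ℝ}
    (hδ : 0 ≤ δ) (hc : ∀ i, ∀ x ∈ U i, |c i - f x| ≤ δ) :
    ∃ g : C(X, ℝ), dist g f ≤ δ ∧ ∀ x ∉ N, ∃ i, x ∈ U i ∧ g x = c i := by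
  have hsel : ∀ σ : Set (Fin n), ∃ i : Fin n ⊕ Unit, ∀ k ∈ σ, ∃ j ∈ σ, i = Sum.inl j := by
    intro σ
    rcases σ.eq_empty_or_nonempty with rfl | ⟨j, hj⟩
    · exact ⟨Sum.inr (), by simp⟩
    · exact ⟨Sum.inl j, fun _ _ => ⟨j, hj, rfl⟩⟩
  choose sel hsel using hsel
  let v : X → ℝ := fun x => Sum.elim c 0 (sel {i | x ∈ U i})
  have hv : ∀ x, ∃ i, x ∈ U i ∧ v x = c i := by
    intro x
    obtain ⟨k, hk⟩ := hcov x
    obtain ⟨j, hj, he⟩ := hsel {i | x ∈ U i} k hk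
    exact ⟨j, hj, by simp [v, he]⟩
  have hvc : ∀ x ∉ N, ContinuousAt v x := by
    intro x hx
    have hev : ∀ᶠ y in 𝓝 x, ∀ i, y ∈ U i ↔ x ∈ U i :=
      Filter.eventually_all.2 fun i =>
        eventually_mem_iff_of_notMem_frontier fun hi => hx (hfr i hi)
    refine (continuousAt_const (y := v x)).congr ?_
    filter_upwards [hev] with y hy
    simp only [v, hy]
  let w : C((Nᶜ : Set X), ℝ) :=
    ⟨fun x => v x - f x, by
      refine Continuous.sub ?_ (f.continuous.comp continuous_subtype_val)
      exact continuous_iff_continuousAt.2 fun x =>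
        (hvc x x.2).comp continuous_subtype_val.continuousAt⟩
  obtain ⟨h, hh, hw⟩ := w.exists_restrict_eq_forall_mem_of_closed (t := Icc (-δ) δ)
    (fun x => by
      obtain ⟨i, hi, he⟩ := hv x
      have := hc i x hi
      rw [← he] at this
      exact abs_le.1 this) ⟨0, by simp [hδ]⟩ hN.isClosed_compl
  refine ⟨f + h, ?_, fun x hx => ?_⟩
  · refine (ContinuousMap.dist_le hδ).2 fun x => ?_
    rw [Real.dist_eq]
    simpa using abs_le.2 (hh x)
  · obtain ⟨i, hi, he⟩ := hv x
    refine ⟨i, hi, ?_⟩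
    have := DFunLike.congr_fun hw (⟨x, hx⟩ : (Nᶜ : Set X))
    simp only [ContinuousMap.restrict_apply, w, ContinuousMap.coe_mk] at this
    simp [this, he]

lemma forall_hasCover_preimage_mem_residual {K : Type*} [MetricSpace K] [CompactSpace K]
    [MeasurableSpace K] [BorelSpace K] {s : ℝ} (hs : 0 < s) {𝒰 : Set (Set K)}
    (hB : TopologicalSpace.IsTopologicalBasis 𝒰) (h𝒰 : ∀ U ∈ 𝒰, μH[s] (frontier U) = 0)
    {ε : ENNReal} (hε : ε ≠ 0) :
    {f : C(K, ℝ) | ∀ y : ℝ, HasCover s ε (f ⁻¹' {y})} ∈ residual C(K, ℝ) := by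
  refine mem_residual_of_forall_exists_ball_subset fun f₀ δ hδ => ?_
  have hε2 : ε / 2 ≠ 0 := by simpa using hε
  obtain ⟨ρ₁, hρ₁, huc⟩ := Metric.uniformContinuous_iff.1
    (CompactSpace.uniformContinuous_of_continuous f₀.continuous) (δ / 4) (by positivity)
  obtain ⟨ρ, hρ0, hρ, hρs⟩ : ∃ ρ > 0, ρ < ρ₁ ∧ ENNReal.ofReal (2 * ρ) ^ s ≤ ε / 2 := by
    have hc : Continuous fun ρ : ℝ => ENNReal.ofReal (2 * ρ) ^ s :=
      ENNReal.continuous_rpow_const.comp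
        (ENNReal.continuous_ofReal.comp (continuous_const_mul 2))
    have hlt : ENNReal.ofReal (2 * 0) ^ s < ε / 2 := by
      simpa [hs] using hε
    have hev : ∀ᶠ ρ : ℝ in 𝓝[>] 0, ρ < ρ₁ ∧ ENNReal.ofReal (2 * ρ) ^ s < ε / 2 :=
      ((eventually_lt_nhds hρ₁).and (hc.tendsto 0 |>.eventually_lt_const hlt)).filter_mono
        nhdsWithin_le_nhds
    obtain ⟨ρ, h, h0⟩ := (hev.and self_mem_nhdsWithin).exists
    exact ⟨ρ, h0, h.1, h.2.le⟩
  choose V hV hxV hVb using fun x : K =>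
    hB.exists_subset_of_mem_open (mem_ball_self hρ0 : x ∈ ball x ρ) isOpen_ball
  obtain ⟨t, ht⟩ := CompactSpace.elim_nhds_subcover V
    fun x => (hB.isOpen (hV x)).mem_nhds (hxV x)
  let p : Fin t.card → K := fun i => t.equivFin.symm i
  have hcov : ∀ x, ∃ i, x ∈ V (p i) := by
    intro x
    have hx : x ∈ ⋃ z ∈ t, V z := ht ▸ mem_univ x
    obtain ⟨z, hz, hxz⟩ := mem_iUnion₂.1 hx
    exact ⟨t.equivFin ⟨z, hz⟩, by simpa [p] using hxz⟩
  obtain ⟨c, hcinj, hc⟩ := exists_injective_abs_sub_le (fun i => f₀ (p i))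
    (show 0 < δ / 4 by positivity)
  have hA : μH[s] (⋃ i, frontier (V (p i))) = 0 :=
    measure_iUnion_null fun i => h𝒰 _ (hV _)
  obtain ⟨N, hN, hAN, hNcov⟩ := exists_isOpen_hasCover hs hA hε2
  obtain ⟨g, hg, hgc⟩ := exists_approx_piecewise_const hcov hN
    (fun i => (subset_iUnion (fun i => frontier (V (p i))) i).trans hAN) f₀ c
    (show 0 ≤ δ / 2 by positivity) fun i x hx => by
      have h1 : dist (f₀ x) (f₀ (p i)) < δ / 4 := huc ((mem_ball.1 (hVb _ hx)).trans hρ)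
      rw [dist_comm, Real.dist_eq] at h1
      have := abs_sub_le (c i) (f₀ (p i)) (f₀ x)
      linarith [hc i]
  obtain ⟨η, hη, hsep⟩ := exists_pos_two_mul_lt_abs_sub hcinj
  refine ⟨g, mem_ball.2 (by linarith), η, hη, fun f hf y => ?_⟩
  have hfg : ∀ x, |f x - g x| < η := fun x =>
    (ContinuousMap.dist_apply_le_dist x).trans_lt hf
  rw [← ENNReal.add_halves ε]
  by_cases hex : ∃ x₀, x₀ ∉ N ∧ f x₀ = y
  · obtain ⟨x₀, hx₀, hy⟩ := hex
    obtain ⟨i, -, hi⟩ := hgc x₀ hx₀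
    refine (hNcov.union (F := V (p i)) ?_).mono fun x hx => ?_
    · refine (ENNReal.rpow_le_rpow (ediam_le_of_forall_dist_le fun a ha b hb => ?_) hs.le).trans hρs
      have h1 := mem_ball.1 (hVb _ ha)
      have h2 := mem_ball.1 (hVb _ hb)
      linarith [dist_triangle_right a b (p i)]
    · by_cases hxN : x ∈ N
      · exact Or.inr hxN
      obtain ⟨j, hj, hjc⟩ := hgc x hxN
      have hji : j = i := by
        by_contra hne
        have h1 := hsep j i hne
        have h2 := abs_lt.1 (hfg x)
        have h3 := abs_lt.1 (hfg x₀)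
        have h4 : f x = y := hx
        rcases lt_abs.1 h1 with h | h <;> linarith
      exact Or.inl (hji ▸ hj)
  · refine (hNcov.union (F := ∅) (by simp [hs])).mono fun x hx => Or.inr ?_
    by_contra hxN
    exact hex ⟨x, hxN, hx⟩

lemma forall_hdim_preimage_le_mem_residual {K : Type*} [MetricSpace K] [CompactSpace K]
    {s : NNReal} (hs : 0 < s) {𝒰 : Set (Set K)} (hB : TopologicalSpace.IsTopologicalBasis 𝒰)
    (h𝒰 : ∀ U ∈ 𝒰, hdim (frontier U) < ((s : ℝ) : EReal)) :
    {f : C(K, ℝ) | ∀ y : ℝ, hdim (f ⁻¹' {y}) ≤ ((s : ℝ) : EReal)} ∈ residual C(K, ℝ) := by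
  borelize K
  have hall : ∀ᶠ f : C(K, ℝ) in residual C(K, ℝ), ∀ n : ℕ, ∀ y : ℝ,
      HasCover s (n : ENNReal)⁻¹ (f ⁻¹' {y}) :=
    eventually_countable_forall.2 fun n =>
      forall_hasCover_preimage_mem_residual (NNReal.coe_pos.2 hs) hB
        (fun U hU => hausdorffMeasure_eq_zero_of_hdim_lt (h𝒰 U hU)) (by simp)
  filter_upwards [hall] with f hf y
  exact hdim_le_of_hausdorffMeasure_eq_zero
    (hausdorffMeasure_eq_zero_of_hasCover (NNReal.coe_pos.2 hs) fun n => hf n y)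

/-- If the functions all of whose level sets have dimension at most `d` are dense in a ball of
`C(X)`, then `X` has a basis of open sets with boundaries of dimension at most `d`. -/
lemma exists_basis_hdim_frontier_le {X : Type*} [MetricSpace X] [CompactSpace X] {d : EReal}
    {f₀ : C(X, ℝ)} {r : ℝ} (hr : 0 < r)
    (h : ∀ f ∈ ball f₀ r, ∀ η > 0, ∃ g ∈ ball f η, ∀ y : ℝ, hdim (g ⁻¹' {y}) ≤ d) :
    ∃ 𝒰 : Set (Set X), TopologicalSpace.IsTopologicalBasis 𝒰 ∧
      ∀ U ∈ 𝒰, hdim (frontier U) ≤ d := by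
  refine ⟨{U | IsOpen U ∧ hdim (frontier U) ≤ d},
    TopologicalSpace.isTopologicalBasis_of_isOpen_of_nhds (fun U hU => hU.1)
      fun p W hpW hW => ?_, fun U hU => hU.2⟩
  have hnhds : W ∩ f₀ ⁻¹' ball (f₀ p) (r / 10) ∈ 𝓝 p :=
    Filter.inter_mem (hW.mem_nhds hpW)
      (f₀.continuous.continuousAt.preimage_mem_nhds (ball_mem_nhds _ (by positivity)))
  obtain ⟨ρ, hρ, hball⟩ := Metric.mem_nhds_iff.1 hnhds
  have hf₀ : ∀ x, dist x p < ρ → |f₀ x - f₀ p| < r / 10 := fun x hx => (hball hx).2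
  let b : C(X, ℝ) := ⟨fun x => -(r / 2) * max 0 (1 - 2 * dist x p / ρ), by fun_prop⟩
  have hb : ∀ x, b x = -(r / 2) * max 0 (1 - 2 * dist x p / ρ) := fun x => rfl
  have hb_abs : ∀ x, |b x| ≤ r / 2 := by
    intro x
    have h0 : 0 ≤ max 0 (1 - 2 * dist x p / ρ) := le_max_left _ _
    have h1 : max 0 (1 - 2 * dist x p / ρ) ≤ 1 :=
      max_le zero_le_one (sub_le_self _ (by positivity))
    rw [hb, abs_le]
    constructor <;> nlinarith
  have hbp : b p = -(r / 2) := by simp [hb]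
  have hb_zero : ∀ x, ρ / 2 ≤ dist x p → b x = 0 := by
    intro x hx
    have : 1 ≤ 2 * dist x p / ρ := by rw [le_div_iff₀ hρ]; linarith
    rw [hb, max_eq_left (by linarith), mul_zero]
  obtain ⟨g, hg, hgd⟩ := h (f₀ + b) (by
    rw [mem_ball]
    refine lt_of_le_of_lt ((ContinuousMap.dist_le (by positivity : 0 ≤ r / 2)).2 fun x => ?_)
      (half_lt_self hr)
    simpa [Real.dist_eq] using hb_abs x) (r / 10) (by positivity)
  have hgx : ∀ x, |g x - (f₀ x + b x)| < r / 10 := fun x =>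
    (ContinuousMap.dist_apply_le_dist x).trans_lt hg
  set q : ℝ := f₀ p - r / 4 with hq
  have hhalf : ∀ x, dist x p < ρ → g x < q → dist x p ≤ ρ / 2 := by
    intro x hx hxq
    by_contra! hlt
    have h1 := abs_lt.1 (hgx x)
    rw [hb_zero x hlt.le] at h1
    have h2 := abs_lt.1 (hf₀ x hx)
    linarith
  have hopen : IsOpen {x | dist x p < ρ ∧ g x < q} :=
    (isOpen_lt (continuous_id.dist continuous_const) continuous_const).inter
      (isOpen_lt g.continuous continuous_const)
  refine ⟨{x | dist x p < ρ ∧ g x < q}, ⟨hopen, (hdim_mono ?_).trans (hgd q)⟩, ⟨?_, ?_⟩,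
    fun x hx => (hball hx.1).1⟩
  · intro x hx
    have hclosed : IsClosed {x | dist x p ≤ ρ / 2 ∧ g x ≤ q} :=
      (isClosed_le (continuous_id.dist continuous_const) continuous_const).inter
        (isClosed_le g.continuous continuous_const)
    have hcl : x ∈ {x | dist x p ≤ ρ / 2 ∧ g x ≤ q} :=
      closure_minimal (fun z hz => And.intro (hhalf z hz.1 hz.2) hz.2.le) hclosed hx.1
    have hnot : ¬ (dist x p < ρ ∧ g x < q) := by
      have := hx.2
      rwa [hopen.interior_eq] at this
    refine le_antisymm hcl.2 (not_lt.1 fun hlt => hnot ⟨?_, hlt⟩)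
    linarith [hcl.1]
  · simpa using hρ
  · have h1 := abs_lt.1 (hgx p)
    rw [hbp] at h1
    linarith

lemma exists_lt_hdim_preimage_mem_residual {K : Type*} [MetricSpace K] [CompactSpace K]
    {d : EReal} (hd : ¬ ∃ 𝒰 : Set (Set K), TopologicalSpace.IsTopologicalBasis 𝒰 ∧
      ∀ U ∈ 𝒰, hdim (frontier U) ≤ d) :
    {f : C(K, ℝ) | ∃ y : ℝ, d < hdim (f ⁻¹' {y})} ∈ residual C(K, ℝ) := by
  refine mem_residual_of_forall_exists_ball_subset ?_
  by_contra! hcon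
  obtain ⟨f₀, r, hr, h⟩ := hcon
  refine hd (exists_basis_hdim_frontier_le (f₀ := f₀) hr fun f hf η hη => ?_)
  obtain ⟨g, hg, hgn⟩ := not_subset.1 (h f hf η hη)
  exact ⟨g, hg, by simpa using hgn⟩

/-- Let `K` be a compact metric space which is not totally disconnected. Then
for the generic `f ∈ C(K)` one has `sup {dim_H f⁻¹(y) : y ∈ ℝ} = dim_tH K − 1`. -/
theorem generic_sup_level_set_dimension
    {K : Type*} [MetricSpace K] [CompactSpace K] (hK : ¬ TotallyDisconnectedSpace K) :
    {f : C(K, ℝ) | (⨆ y : ℝ, hdim (⇑f ⁻¹' {y})) = tHdim K - 1} ∈ residual C(K, ℝ) := by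
  have hne : Nonempty K := by
    by_contra hemp
    rw [not_nonempty_iff] at hemp
    exact hK inferInstance
  have sub_one_lt_iff {a b : EReal} : a - 1 < b ↔ a < b + 1 :=
    EReal.sub_lt_iff (.inl (EReal.coe_ne_bot 1)) (.inl (EReal.coe_ne_top 1))
  have hupper : ∀ᶠ f : C(K, ℝ) in residual C(K, ℝ), ∀ q : ℚ, tHdim K - 1 < ((q : ℝ) : EReal) →
      ∀ y : ℝ, hdim (f ⁻¹' {y}) ≤ ((q : ℝ) : EReal) := by
    refine eventually_countable_forall.2 fun q => ?_
    by_cases hq : tHdim K - 1 < ((q : ℝ) : EReal)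
    swap
    · exact Filter.Eventually.of_forall fun f h => absurd h hq
    rw [sub_one_lt_iff, tHdim, if_pos hne, sInf_lt_iff] at hq
    obtain ⟨d, ⟨𝒰, hB, h𝒰⟩, hdq⟩ := hq
    rw [← sub_one_lt_iff] at hdq
    have hlt : ∀ U ∈ 𝒰, hdim (frontier U) < ((q : ℝ) : EReal) := fun U hU =>
      (h𝒰 U hU).trans_lt hdq
    obtain ⟨U, hU, hUne⟩ : ∃ U ∈ 𝒰, (frontier U).Nonempty := by
      by_contra! hcon
      exact hK (totallyDisconnectedSpace_of_frontier_eq_empty hB hcon)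
    have hq0 : (0 : ℝ) < q := by
      exact_mod_cast (hdim_nonneg hUne).trans_lt (hlt U hU)
    filter_upwards [forall_hdim_preimage_le_mem_residual (s := ⟨q, hq0.le⟩) hq0 hB hlt]
      with f hf _ using hf
  have hlower : ∀ᶠ f : C(K, ℝ) in residual C(K, ℝ), ∀ q : ℚ, ((q : ℝ) : EReal) < tHdim K - 1 →
      ∃ y : ℝ, ((q : ℝ) : EReal) < hdim (f ⁻¹' {y}) := by
    refine eventually_countable_forall.2 fun q => ?_
    by_cases hq : ((q : ℝ) : EReal) < tHdim K - 1
    swap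
    · exact Filter.Eventually.of_forall fun f h => absurd h hq
    have hd : ¬ ∃ 𝒰 : Set (Set K), TopologicalSpace.IsTopologicalBasis 𝒰 ∧
        ∀ U ∈ 𝒰, hdim (frontier U) ≤ ((q : ℝ) : EReal) := by
      rintro ⟨𝒰, hB, h𝒰⟩
      have heq : ((q : ℝ) : EReal) = (((q : ℝ) + 1 : ℝ) : EReal) - 1 := by
        rw [← EReal.coe_one, ← EReal.coe_sub, add_sub_cancel_right]
      have hle : tHdim K ≤ (((q : ℝ) + 1 : ℝ) : EReal) := by
        rw [tHdim, if_pos hne]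
        exact sInf_le ⟨𝒰, hB, fun U hU => heq ▸ h𝒰 U hU⟩
      exact absurd hq (not_lt.2 ((EReal.sub_le_sub hle le_rfl).trans heq.ge))
    filter_upwards [exists_lt_hdim_preimage_mem_residual hd] with f hf _ using hf
  filter_upwards [hupper, hlower] with f hu hl
  refine le_antisymm ?_ ?_
  · refine iSup_le fun y => le_of_not_gt fun hlt => ?_
    obtain ⟨q, hq1, hq2⟩ := EReal.lt_iff_exists_rat_btwn.1 hlt
    exact absurd (hu q hq1 y) (not_le.2 hq2)
  · refine le_of_not_gt fun hlt => ?_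
    obtain ⟨q, hq1, hq2⟩ := EReal.lt_iff_exists_rat_btwn.1 hlt
    obtain ⟨y, hy⟩ := hl q hq2
    exact absurd (hy.trans_le (le_iSup (fun y : ℝ => hdim (f ⁻¹' {y})) y)) (not_lt.2 hq1.le)
end
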